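/- There exist continuum many (i.e., uncountably many, of cardinality 2^ℵ₀) distinct binary sequences that are almost periodic but not eventually strongly almost periodic. Concretely, for each sequence τ : ℕ → {9,10}, defining a₀ = 1, a_{n+1} = aₙ āₙ āₙ aₙ aₙ (where x̄ denotes the bitwise complement of x), c_n^{(τ)} = aₙ repeated τ(n) times, and ω_τ = c₀^{(τ)} c₁^{(τ)} c₂^{(τ)} …, all the sequences ω_τ are pairwise distinct for distinct τ, and each ω_τ is almost periodic but not eventually strongly almost periodic. -/

import Mathlib

/-- The segment of a sequence `ω` of length `l` starting at position `i`,
i.e. the string `ω(i)ω(i+1)…ω(i+l-1)`. -/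
def seg {A : Type*} (ω : ℕ → A) (i l : ℕ) : List A :=
  List.ofFn (fun k : Fin l => ω (i + k))

/-- The string `x` occurs in the sequence `ω` starting at position `i`. -/
def OccursAt {A : Type*} (ω : ℕ → A) (x : List A) (i : ℕ) : Prop :=
  seg ω i x.length = x

/-- A sequence is strongly almost periodic if every string occurring in it
occurs in every segment of some fixed length `l`. -/
def StronglyAP {A : Type*} (ω : ℕ → A) : Prop :=
  ∀ x : List A, (∃ i, OccursAt ω x i) →
    ∃ l, ∀ i, ∃ j, i ≤ j ∧ j + x.length ≤ i + l ∧ OccursAt ω x j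

/-- A sequence is almost periodic if every string occurring in it infinitely many
times occurs in every segment of some fixed length `l`. -/
def AlmostPeriodic {A : Type*} (ω : ℕ → A) : Prop :=
  ∀ x : List A, (∀ N, ∃ i, N ≤ i ∧ OccursAt ω x i) →
    ∃ l, ∀ i, ∃ j, i ≤ j ∧ j + x.length ≤ i + l ∧ OccursAt ω x j

/-- The sequence `aν` obtained by prepending the finite string `a` to the sequence `ν`. -/
def appendSeq {A : Type*} (a : List A) (ν : ℕ → A) : ℕ → A :=
  fun n => if h : n < a.length then a[n]'h else ν (n - a.length)

/-- A sequence is eventually strongly almost periodic if it equals `aν` for some finite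
string `a` and strongly almost periodic sequence `ν`. -/
def EventuallySAP {A : Type*} (ω : ℕ → A) : Prop :=
  ∃ (a : List A) (ν : ℕ → A), StronglyAP ν ∧ ω = appendSeq a ν

/-- The bitwise complement of a binary string: every `0` is changed to `1` and vice versa. -/
def bcomp (x : List Bool) : List Bool := x.map (fun b => !b)

/-- The strings `a₀ = 1`, `a_{n+1} = aₙ āₙ āₙ aₙ aₙ`. -/
def aStr : ℕ → List Bool
  | 0 => [true]
  | n + 1 => aStr n ++ bcomp (aStr n) ++ bcomp (aStr n) ++ aStr n ++ aStr n

/-- The string `cₙ`: the concatenation of 10 copies of `aₙ`. -/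
def cStr (n : ℕ) : List Bool := (List.replicate 10 (aStr n)).flatten

/-- The finite prefix `c₀c₁…c_{n-1}` of `ω`; its length is `lₙ = (5/2)(5ⁿ − 1)`. -/
def prefixStr (n : ℕ) : List Bool := (List.ofFn fun k : Fin n => cStr k).flatten

/-- The sequence `ω = c₀c₁c₂c₃…` (the `m`-th symbol lies in the prefix
`c₀…c_m`, which has length greater than `m`). -/
def omegaSeq (m : ℕ) : Bool := (prefixStr (m + 1)).getD m false

/-- The string `c_n^{(τ)}`: the concatenation of `τ(n)` copies of `aₙ`. -/
def cTau (τ : ℕ → ℕ) (n : ℕ) : List Bool := (List.replicate (τ n) (aStr n)).flatten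

/-- The finite prefix `c₀^{(τ)}c₁^{(τ)}…c_{n-1}^{(τ)}` of `ω_τ`. -/
def prefixTau (τ : ℕ → ℕ) (n : ℕ) : List Bool := (List.ofFn fun k : Fin n => cTau τ k).flatten

/-- The sequence `ω_τ = c₀^{(τ)}c₁^{(τ)}c₂^{(τ)}…` (for `τ` with values in `{9,10}` the
`m`-th symbol lies in the prefix `c₀^{(τ)}…c_m^{(τ)}`, which has length greater than `m`). -/
def omegaTau (τ : ℕ → ℕ) (m : ℕ) : Bool := (prefixTau τ (m + 1)).getD m false

theorem occursAt_iff {A : Type*} {ω : ℕ → A} {x : List A} {i : ℕ} :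
    OccursAt ω x i ↔ ∀ u (h : u < x.length), ω (i + u) = x[u] := by
  unfold OccursAt seg
  constructor
  · intro h u hu
    have := List.getElem_of_eq h (i := u) (by simpa using hu)
    simpa using this
  · intro h
    apply List.ext_getElem (by simp)
    intro u h₁ h₂
    simpa using h u h₂

theorem occursAt_seg {A : Type*} {ω : ℕ → A} {i l j : ℕ} :
    OccursAt ω (seg ω i l) j ↔ ∀ u < l, ω (j + u) = ω (i + u) := by
  simp [occursAt_iff, seg]

/-- The string `a₁ = 10011`, read as a function of the position. -/
def baseWord (d : ℕ) : Bool := decide (d = 0 ∨ 3 ≤ d)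

/-- The infinite sequence having all the strings `aₙ` as prefixes. -/
def limitSeq : ℕ → Bool
  | 0 => true
  | m + 1 => limitSeq ((m + 1) / 5) == baseWord ((m + 1) % 5)

theorem limitSeq_eq (m : ℕ) : limitSeq m = (limitSeq (m / 5) == baseWord (m % 5)) := by
  cases m with
  | zero => simp [limitSeq, baseWord]
  | succ m => rw [limitSeq]

@[simp] theorem limitSeq_zero : limitSeq 0 = true := by rw [limitSeq]

theorem limitSeq_of_lt_five {d : ℕ} (hd : d < 5) : limitSeq d = baseWord d := by
  rw [limitSeq_eq, Nat.div_eq_of_lt hd, Nat.mod_eq_of_lt hd]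
  simp

theorem limitSeq_mul_add (n q : ℕ) {r : ℕ} (hr : r < 5 ^ n) :
    limitSeq (5 ^ n * q + r) = (limitSeq q == limitSeq r) := by
  induction n generalizing r with
  | zero =>
    obtain rfl : r = 0 := by simpa using hr
    simp
  | succ n ih =>
    have h : 5 ^ (n + 1) * q = 5 * (5 ^ n * q) := by ring
    have hr' : r / 5 < 5 ^ n := by rw [pow_succ] at hr; omega
    rw [limitSeq_eq, limitSeq_eq r, h,
      show (5 * (5 ^ n * q) + r) / 5 = 5 ^ n * q + r / 5 by omega,
      show (5 * (5 ^ n * q) + r) % 5 = r % 5 by omega, ih hr']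
    cases limitSeq q <;> cases limitSeq (r / 5) <;> cases baseWord (r % 5) <;> rfl

theorem map_limitSeq_block (n d : ℕ) :
    (List.range (5 ^ n)).map (fun r => limitSeq (5 ^ n * d + r)) =
      (List.range (5 ^ n)).map (fun r => limitSeq d == limitSeq r) :=
  List.map_congr_left fun _ hr => limitSeq_mul_add n d (List.mem_range.1 hr)

theorem aStr_eq_map (n : ℕ) : aStr n = (List.range (5 ^ n)).map limitSeq := by
  induction n with
  | zero => simp [aStr]
  | succ n ih =>
    have h : 5 ^ (n + 1) = 5 ^ n * 1 + 5 ^ n + 5 ^ n + 5 ^ n + 5 ^ n := by ring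
    have h₁ := map_limitSeq_block n 1
    have h₂ := map_limitSeq_block n 2
    have h₃ := map_limitSeq_block n 3
    have h₄ := map_limitSeq_block n 4
    rw [limitSeq_of_lt_five (by norm_num)] at h₁ h₂ h₃ h₄
    rw [aStr, ih, h, List.range_add, List.range_add, List.range_add, List.range_add]
    simp only [bcomp, List.map_append, List.map_map, Function.comp_def,
      show 5 ^ n * 1 + 5 ^ n = 5 ^ n * 2 by ring, show 5 ^ n * 2 + 5 ^ n = 5 ^ n * 3 by ring,
      show 5 ^ n * 3 + 5 ^ n = 5 ^ n * 4 by ring, h₁, h₂, h₃, h₄]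
    simp [baseWord]

theorem flatten_replicate_map_range {A : Type*} (f : ℕ → A) (k N : ℕ) :
    (List.replicate k ((List.range N).map f)).flatten =
      (List.range (k * N)).map (fun j => f (j % N)) := by
  induction k with
  | zero => simp
  | succ k ih =>
    rw [List.replicate_succ', List.flatten_append, ih, Nat.succ_mul, List.range_add]
    simp only [List.map_append, List.map_map, List.flatten_singleton]
    congr 1
    refine List.map_congr_left fun r hr => ?_
    simp [Nat.mod_eq_of_lt (List.mem_range.1 hr)]

theorem cTau_eq_map (τ : ℕ → ℕ) (n : ℕ) :
    cTau τ n = (List.range (τ n * 5 ^ n)).map (fun j => limitSeq (j % 5 ^ n)) := by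
  rw [cTau, aStr_eq_map, flatten_replicate_map_range]

theorem prefixTau_succ (τ : ℕ → ℕ) (n : ℕ) :
    prefixTau τ (n + 1) = prefixTau τ n ++ cTau τ n := by
  rw [prefixTau, List.ofFn_succ_last]
  simp [prefixTau]

/-- The position at which the block `c_n^{(τ)}` starts. -/
def startTau (τ : ℕ → ℕ) (n : ℕ) : ℕ := (prefixTau τ n).length

@[simp] theorem startTau_zero (τ : ℕ → ℕ) : startTau τ 0 = 0 := by
  simp [startTau, prefixTau]

theorem startTau_succ (τ : ℕ → ℕ) (n : ℕ) :
    startTau τ (n + 1) = startTau τ n + τ n * 5 ^ n := by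
  simp [startTau, prefixTau_succ, cTau_eq_map]

theorem startTau_mono (τ : ℕ → ℕ) : Monotone (startTau τ) :=
  monotone_nat_of_le_succ fun n => by simp [startTau_succ]

theorem le_startTau {τ : ℕ → ℕ} (hτ : ∀ n, 0 < τ n) (n : ℕ) : n ≤ startTau τ n := by
  induction n with
  | zero => simp
  | succ n ih =>
    have := Nat.mul_pos (hτ n) (pow_pos (show 0 < 5 by norm_num) n)
    rw [startTau_succ]
    omega

theorem omegaTau_startTau_add {τ : ℕ → ℕ} (hτ : ∀ n, 0 < τ n) {n j : ℕ}
    (hj : j < τ n * 5 ^ n) :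
    omegaTau τ (startTau τ n + j) = limitSeq (j % 5 ^ n) := by
  have mono : ∀ {a b : ℕ}, a ≤ b → prefixTau τ a <+: prefixTau τ b := by
    intro a b hab
    induction b, hab using Nat.le_induction with
    | base => exact List.prefix_rfl
    | succ b _ ih =>
      rw [prefixTau_succ]
      exact ih.trans (List.prefix_append _ _)
  set p := startTau τ n + j with hp
  have hn : p < (prefixTau τ (n + 1)).length := by
    change p < startTau τ (n + 1)
    rw [startTau_succ]
    omega
  have hpp : p < (prefixTau τ (p + 1)).length := le_startTau hτ (p + 1)
  have key : (prefixTau τ (p + 1))[p] = (prefixTau τ (n + 1))[p] := by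
    rcases le_total (p + 1) (n + 1) with h | h
    · exact (mono h).getElem hpp
    · exact ((mono h).getElem hn).symm
  rw [omegaTau, List.getD_eq_getElem _ _ hpp, key]
  simp only [prefixTau_succ]
  rw [List.getElem_append_right (by change startTau τ n ≤ p; omega)]
  simp only [cTau_eq_map, List.getElem_map, List.getElem_range]
  change limitSeq ((p - startTau τ n) % 5 ^ n) = _
  rw [hp, Nat.add_sub_cancel_left]

theorem omegaTau_startTau {τ : ℕ → ℕ} (hτ : ∀ n, 0 < τ n) (n : ℕ) :
    omegaTau τ (startTau τ n) = true := by
  simpa using omegaTau_startTau_add hτ (n := n) (j := 0) (by have := hτ n; positivity)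

theorem omegaTau_block {τ : ℕ → ℕ} (hτ : ∀ n, 0 < τ n) (n k : ℕ) {r : ℕ} (hr : r < 5 ^ n) :
    omegaTau τ (startTau τ n + 5 ^ n * k + r) =
      (omegaTau τ (startTau τ n + 5 ^ n * k) == limitSeq r) := by
  have dvd : ∀ m, n ≤ m → ∃ c, startTau τ m = startTau τ n + 5 ^ n * c := by
    intro m hm
    induction m, hm using Nat.le_induction with
    | base => exact ⟨0, by simp⟩
    | succ m hm ih =>
      obtain ⟨c, hc⟩ := ih
      obtain ⟨e, rfl⟩ := Nat.exists_eq_add_of_le hm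
      exact ⟨c + τ (n + e) * 5 ^ e, by rw [startTau_succ, hc]; ring⟩
  obtain ⟨m, hnm, hle, hlt⟩ : ∃ m, n ≤ m ∧ startTau τ m ≤ startTau τ n + 5 ^ n * k ∧
      startTau τ n + 5 ^ n * k < startTau τ (m + 1) := by
    have hex : ∃ m, startTau τ n + 5 ^ n * k < startTau τ (m + 1) :=
      ⟨_, le_startTau hτ _⟩
    have hspec := Nat.find_spec hex
    have hn : n ≤ Nat.find hex := by
      by_contra! hlt
      have := startTau_mono τ (show Nat.find hex + 1 ≤ n from hlt)
      omega
    refine ⟨Nat.find hex, hn, ?_, hspec⟩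
    rcases hn.eq_or_lt with h | h
    · rw [← h]; omega
    · obtain ⟨m, hm⟩ : ∃ m, Nat.find hex = m + 1 := ⟨Nat.find hex - 1, by omega⟩
      have := Nat.find_min hex (m := m) (by omega)
      rw [hm]
      omega
  obtain ⟨c, hc⟩ := dvd m hnm
  obtain ⟨e, rfl⟩ := Nat.exists_eq_add_of_le hnm
  have hpos : 0 < 5 ^ n := by positivity
  have hck : c ≤ k := by
    rw [hc] at hle
    exact Nat.le_of_mul_le_mul_left (by omega) hpos
  obtain ⟨q, rfl⟩ := Nat.exists_eq_add_of_le hck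
  have hstart : startTau τ n + 5 ^ n * (c + q) = startTau τ (n + e) + 5 ^ n * q := by
    rw [hc]; ring
  have hq : q < τ (n + e) * 5 ^ e := by
    rw [hstart, startTau_succ, pow_add] at hlt
    refine lt_of_mul_lt_mul_left (a := 5 ^ n) ?_ hpos.le
    calc 5 ^ n * q < τ (n + e) * (5 ^ n * 5 ^ e) := by omega
      _ = _ := by ring
  have value : ∀ s < 5 ^ n, omegaTau τ (startTau τ (n + e) + (5 ^ n * q + s)) =
      (limitSeq (q % 5 ^ e) == limitSeq s) := by
    intro s hs
    have hj : 5 ^ n * q + s < τ (n + e) * 5 ^ (n + e) := by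
      calc 5 ^ n * q + s < 5 ^ n * (q + 1) := by rw [mul_add]; omega
        _ ≤ 5 ^ n * (τ (n + e) * 5 ^ e) := Nat.mul_le_mul_left _ hq
        _ = _ := by ring
    rw [omegaTau_startTau_add hτ hj, pow_add, Nat.mod_mul, Nat.mul_add_mod, Nat.mod_eq_of_lt hs,
      Nat.mul_add_div hpos, Nat.div_eq_of_lt hs, add_zero, add_comm s, limitSeq_mul_add _ _ hs]
  have h₀ := value 0 hpos
  rw [hstart, add_assoc, value r hr]
  simp only [add_zero, limitSeq_zero] at h₀
  rw [h₀]
  simp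

theorem omegaTau_subblock {τ : ℕ → ℕ} (hτ : ∀ n, 0 < τ n) (n k : ℕ) {d r : ℕ}
    (hd : d < 5) (hr : r < 5 ^ n) :
    omegaTau τ (startTau τ (n + 1) + 5 ^ (n + 1) * k + (5 ^ n * d + r)) =
      (omegaTau τ (startTau τ (n + 1) + 5 ^ (n + 1) * k) == (baseWord d == limitSeq r)) := by
  have : 5 ^ n * d + r < 5 ^ (n + 1) := by
    calc 5 ^ n * d + r < 5 ^ n * (d + 1) := by rw [mul_add]; omega
      _ ≤ 5 ^ n * 5 := Nat.mul_le_mul_left _ hd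
      _ = _ := (pow_succ _ _).symm
  rw [omegaTau_block hτ _ _ this, limitSeq_mul_add _ _ hr, limitSeq_of_lt_five hd]

theorem almostPeriodic_omegaTau {τ : ℕ → ℕ} (hτ : ∀ n, 0 < τ n) :
    AlmostPeriodic (omegaTau τ) := by
  intro x hx
  obtain ⟨n, hn⟩ : ∃ n, x.length ≤ 5 ^ n :=
    ⟨x.length, (Nat.lt_pow_self (by norm_num)).le⟩
  obtain ⟨i, hi, hocc⟩ := hx (startTau τ n)
  have hpos : 0 < 5 ^ n := by positivity
  obtain ⟨k, s, hs, rfl⟩ : ∃ k s, s < 5 ^ n ∧ i = startTau τ n + 5 ^ n * k + s := by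
    refine ⟨(i - startTau τ n) / 5 ^ n, (i - startTau τ n) % 5 ^ n, Nat.mod_lt _ hpos, ?_⟩
    have := Nat.div_add_mod (i - startTau τ n) (5 ^ n)
    omega
  rw [occursAt_iff] at hocc
  refine ⟨startTau τ (n + 1) + 3 * 5 ^ (n + 1), fun i => ?_⟩
  set k' := i / 5 ^ (n + 1) + 1 with hk'
  have hdiv := Nat.div_add_mod i (5 ^ (n + 1))
  have hmod := Nat.mod_lt i (show 0 < 5 ^ (n + 1) by positivity)
  have hmul : 5 ^ (n + 1) * k' = 5 ^ (n + 1) * (i / 5 ^ (n + 1)) + 5 ^ (n + 1) := by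
    rw [hk', mul_add, mul_one]
  obtain ⟨d, hd, hd₀, hd₁⟩ : ∃ d < 4,
      (omegaTau τ (startTau τ (n + 1) + 5 ^ (n + 1) * k') == baseWord d) =
        omegaTau τ (startTau τ n + 5 ^ n * k) ∧
      (omegaTau τ (startTau τ (n + 1) + 5 ^ (n + 1) * k') == baseWord (d + 1)) =
        omegaTau τ (startTau τ n + 5 ^ n * (k + 1)) := by
    generalize omegaTau τ (startTau τ (n + 1) + 5 ^ (n + 1) * k') = δ
    generalize omegaTau τ (startTau τ n + 5 ^ n * k) = β
    generalize omegaTau τ (startTau τ n + 5 ^ n * (k + 1)) = γ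
    revert δ β γ
    decide
  have hd5 : 5 ^ n * d ≤ 5 ^ n * 3 := Nat.mul_le_mul_left _ (by omega)
  have hp : 5 ^ (n + 1) = 5 ^ n * 5 := pow_succ _ _
  refine ⟨startTau τ (n + 1) + 5 ^ (n + 1) * k' + (5 ^ n * d + s), by omega, by omega, ?_⟩
  rw [occursAt_iff]
  intro u hu
  rw [← hocc u hu]
  have assoc : ∀ a b c : Bool, (a == (b == c)) = ((a == b) == c) := by decide
  rcases lt_or_ge (s + u) (5 ^ n) with h | h
  · rw [add_assoc, add_assoc (5 ^ n * d), omegaTau_subblock hτ _ _ (by omega) h,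
      add_assoc _ s, omegaTau_block hτ _ _ h, assoc, hd₀]
  · obtain ⟨v, hv⟩ := Nat.exists_eq_add_of_le h
    have hvlt : v < 5 ^ n := by omega
    rw [show startTau τ (n + 1) + 5 ^ (n + 1) * k' + (5 ^ n * d + s) + u =
        startTau τ (n + 1) + 5 ^ (n + 1) * k' + (5 ^ n * (d + 1) + v) by
          rw [mul_add (5 ^ n) d]; omega,
      show startTau τ n + 5 ^ n * k + s + u = startTau τ n + 5 ^ n * (k + 1) + v by
        rw [mul_add (5 ^ n) k]; omega,
      omegaTau_subblock hτ _ _ (by omega) hvlt, omegaTau_block hτ _ _ hvlt, assoc, hd₁]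

/-- The string `c_n^{(τ)}` has period `5ⁿ`, whereas every later window of the same length
contains two complementary symbols at distance `5ⁿ`. -/
theorem not_occursAt_of_startTau_succ_le {τ : ℕ → ℕ} (hτ : ∀ n, 6 ≤ τ n) {n i : ℕ}
    (hi : startTau τ (n + 1) ≤ i) :
    ¬ OccursAt (omegaTau τ) (seg (omegaTau τ) (startTau τ n) (τ n * 5 ^ n)) i := by
  have hτ' : ∀ n, 0 < τ n := fun n => by have := hτ n; omega
  rw [occursAt_seg]
  intro h
  have hpos : 0 < 5 ^ n := by positivity
  have hlen : 6 * 5 ^ n ≤ τ n * 5 ^ n := Nat.mul_le_mul_right _ (hτ n)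
  have hp : 5 ^ (n + 1) = 5 ^ n * 5 := pow_succ _ _
  obtain ⟨k, u, hu, hk⟩ : ∃ k u, u < 5 ^ (n + 1) ∧
      startTau τ (n + 1) + 5 ^ (n + 1) * k = i + u := by
    set e := i - startTau τ (n + 1) with he
    have hdiv := Nat.div_add_mod (e + (5 ^ (n + 1) - 1)) (5 ^ (n + 1))
    have hmod := Nat.mod_lt (e + (5 ^ (n + 1) - 1)) (show 0 < 5 ^ (n + 1) by positivity)
    refine ⟨(e + (5 ^ (n + 1) - 1)) / 5 ^ (n + 1),
      5 ^ (n + 1) - 1 - (e + (5 ^ (n + 1) - 1)) % 5 ^ (n + 1), by omega, by omega⟩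
  have h₀ := h u (by omega)
  have h₁ := h (u + 5 ^ n) (by omega)
  rw [omegaTau_startTau_add hτ' (by omega)] at h₀ h₁
  rw [Nat.add_mod_right, ← h₀, ← add_assoc, ← hk] at h₁
  have h₂ := omegaTau_subblock hτ' n k (d := 1) (r := 0) (by norm_num) hpos
  simp only [mul_one, add_zero] at h₂
  rw [h₁] at h₂
  simp [baseWord] at h₂

theorem not_eventuallySAP_omegaTau {τ : ℕ → ℕ} (hτ : ∀ n, 6 ≤ τ n) :
    ¬ EventuallySAP (omegaTau τ) := by
  have hτ' : ∀ n, 0 < τ n := fun n => by have := hτ n; omega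
  rintro ⟨a, ν, hν, hω⟩
  have shift : ∀ m, ν m = omegaTau τ (m + a.length) := fun m => by simp [hω, appendSeq]
  set n := a.length
  have hn : n ≤ startTau τ n := le_startTau hτ' n
  set x := seg (omegaTau τ) (startTau τ n) (τ n * 5 ^ n) with hx
  have occ : ∀ j, OccursAt ν x j ↔ OccursAt (omegaTau τ) x (j + n) := by
    intro j
    simp only [occursAt_iff, shift, add_right_comm]
  obtain ⟨l, hl⟩ := hν x ⟨startTau τ n - n, by
    rw [occ, Nat.sub_add_cancel hn, hx, occursAt_seg]
    exact fun _ _ => rfl⟩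
  obtain ⟨j, hj, -, hjx⟩ := hl (startTau τ (n + 1))
  exact not_occursAt_of_startTau_succ_le hτ (by omega) ((occ j).1 hjx)

theorem omegaTau_ne_of_nine_of_ten {τ σ : ℕ → ℕ} (hτ : ∀ n, 0 < τ n) (hσ : ∀ n, 0 < σ n) {n : ℕ}
    (hlt : ∀ m < n, τ m = σ m) (hτn : τ n = 9) (hσn : σ n = 10) : omegaTau τ ≠ omegaTau σ := by
  intro h
  have hstart : ∀ m ≤ n, startTau τ m = startTau σ m := by
    intro m hm
    induction m with
    | zero => simp
    | succ m ih => rw [startTau_succ, startTau_succ, ih (by omega), hlt m (by omega)]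
  have h₁ := omegaTau_subblock hτ n 0 (d := 1) (r := 0) (by norm_num) (by positivity)
  simp only [mul_zero, mul_one, add_zero, omegaTau_startTau hτ] at h₁
  have h₂ := omegaTau_startTau hσ (n + 1)
  rw [show startTau σ (n + 1) = startTau τ (n + 1) + 5 ^ n by
    rw [startTau_succ, startTau_succ, hstart n le_rfl, hτn, hσn]; ring, ← h, h₁] at h₂
  simp [baseWord] at h₂

theorem omegaTau_ne {τ σ : ℕ → ℕ} (hτ : ∀ n, τ n = 9 ∨ τ n = 10) (hσ : ∀ n, σ n = 9 ∨ σ n = 10)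
    (hne : τ ≠ σ) : omegaTau τ ≠ omegaTau σ := by
  have hτ' : ∀ n, 0 < τ n := fun n => by have := hτ n; omega
  have hσ' : ∀ n, 0 < σ n := fun n => by have := hσ n; omega
  have hex : ∃ n, τ n ≠ σ n := Function.ne_iff.1 hne
  have hlt : ∀ m < Nat.find hex, τ m = σ m := fun m hm => not_not.1 (Nat.find_min hex hm)
  have hspec := Nat.find_spec hex
  rcases hτ (Nat.find hex) with h₁ | h₁ <;> rcases hσ (Nat.find hex) with h₂ | h₂
  · omega
  · exact omegaTau_ne_of_nine_of_ten hτ' hσ' hlt h₁ h₂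
  · exact (omegaTau_ne_of_nine_of_ten hσ' hτ' (fun m hm => (hlt m hm).symm) h₂ h₁).symm
  · omega

/-- There are continuum many binary sequences that are almost periodic but not eventually
strongly almost periodic: the sequences `ω_τ` for `τ : ℕ → {9,10}` are pairwise distinct
for distinct `τ`, each of them is almost periodic but not eventually strongly almost
periodic, and the class of such sequences has cardinality `2 ^ ℵ₀`. -/
theorem continuum_many_almostPeriodic_not_eventuallySAP :
    (∀ τ σ : ℕ → ℕ, (∀ n, τ n = 9 ∨ τ n = 10) → (∀ n, σ n = 9 ∨ σ n = 10) →
      τ ≠ σ → omegaTau τ ≠ omegaTau σ) ∧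
    (∀ τ : ℕ → ℕ, (∀ n, τ n = 9 ∨ τ n = 10) →
      AlmostPeriodic (omegaTau τ) ∧ ¬ EventuallySAP (omegaTau τ)) ∧
    Cardinal.mk {ω : ℕ → Bool // AlmostPeriodic ω ∧ ¬ EventuallySAP ω} =
      2 ^ Cardinal.aleph0 := by
  have main : ∀ τ : ℕ → ℕ, (∀ n, τ n = 9 ∨ τ n = 10) →
      AlmostPeriodic (omegaTau τ) ∧ ¬ EventuallySAP (omegaTau τ) := fun τ hτ =>
    ⟨almostPeriodic_omegaTau fun n => by have := hτ n; omega,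
      not_eventuallySAP_omegaTau fun n => by have := hτ n; omega⟩
  refine ⟨fun τ σ hτ hσ hne => omegaTau_ne hτ hσ hne, main, ?_⟩
  have card : Cardinal.mk (ℕ → Bool) = 2 ^ Cardinal.aleph0 := by simp
  refine le_antisymm (card ▸ Cardinal.mk_subtype_le _) ?_
  rw [← card]
  let code : (ℕ → Bool) → ℕ → ℕ := fun f n => if f n then 10 else 9
  have hcode : ∀ f n, code f n = 9 ∨ code f n = 10 := fun f n => by
    by_cases h : f n <;> simp [code, h]
  refine Cardinal.mk_le_of_injective (f := fun f => ⟨omegaTau (code f), main _ (hcode f)⟩) ?_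
  intro f g hfg
  by_contra hne
  refine omegaTau_ne (hcode f) (hcode g) (fun h => hne (funext fun n => ?_))
    (congrArg Subtype.val hfg)
  have := congrFun h n
  cases hf : f n <;> cases hg : g n <;> simp_all [code]
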